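/- arXiv:1603.05621 — 4 statements merged into one kernel-verified Lean document; each statement's English description precedes it below -/
import Mathlib

section
/- Let A be an order-k real tensor with dimensions (d₁,…,d_k), let π₁, π₂ be any two partitions of [k], and let 1 ≤ p ≤ 2. Then [dim(A)]^{−1/p} · [dim_A(π₁,π₂)]^{1/2} · ‖Unfold_{π₁}(A)‖_p ≤ ‖Unfold_{π₂}(A)‖_p ≤ [dim(A)]^{1/p} · [dim_A(π₂,π₁)]^{−1/2} · ‖Unfold_{π₁}(A)‖_p. -/
open scoped BigOperators ENNReal

namespace TensorUnfolding

/-- The vector `l^p` norm of a finitely-indexed real vector, for `p ∈ [1, ∞]`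
(for `p = ∞` it is the maximum of the absolute values of the entries). -/
noncomputable def pNorm (p : ℝ≥0∞) {ι : Type} [Fintype ι] (x : ι → ℝ) : ℝ :=
  if p = ⊤ then ⨆ i, |x i| else (∑ i, |x i| ^ p.toReal) ^ (1 / p.toReal)

/-- `π` is a partition of `[k] = {0, …, k-1}`: a collection of disjoint nonempty
blocks whose union is all of `Fin k`. -/
def IsPartition {k : ℕ} (π : Finset (Finset (Fin k))) : Prop :=
  (∀ B ∈ π, B.Nonempty) ∧
  (∀ B ∈ π, ∀ B' ∈ π, B ≠ B' → Disjoint B B') ∧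
  π.sup id = Finset.univ

/-- `π₁ ≤ π₂`: every block of `π₁` is contained in some block of `π₂`. -/
def Refines {k : ℕ} (π₁ π₂ : Finset (Finset (Fin k))) : Prop :=
  ∀ B ∈ π₁, ∃ B' ∈ π₂, B ⊆ B'

/-- The finest partition `0_{[k]} = {{1}, …, {k}}`. -/
def botPartition (k : ℕ) : Finset (Finset (Fin k)) :=
  Finset.univ.image fun n => {n}

/-- The coarsest (one-block) partition `1_{[k]} = {[k]}`. -/
def topPartition (k : ℕ) : Finset (Finset (Fin k)) :=
  {Finset.univ}

/-- The meet `π₁ ∧ π₂`: the partition whose blocks are the nonempty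
intersections `B ∩ B'` with `B ∈ π₁`, `B' ∈ π₂`. -/
def meetPartition {k : ℕ} (π₁ π₂ : Finset (Finset (Fin k))) : Finset (Finset (Fin k)) :=
  ((π₁ ×ˢ π₂).image fun p => p.1 ∩ p.2).filter fun B => B.Nonempty

/-- The `l^p` operator norm of the unfolding of the tensor `A` induced by the
partition `π`: the supremum of `⟨A, ⊗_{B ∈ π} y_B⟩` over choices, for each block
`B ∈ π`, of a vector `y_B` indexed by `Π_{j ∈ B} Fin (d j)` with `l^p` norm 1. -/
noncomputable def unfoldNormP {k : ℕ} (p : ℝ≥0∞) (d : Fin k → ℕ)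
    (A : ((n : Fin k) → Fin (d n)) → ℝ) (π : Finset (Finset (Fin k))) : ℝ :=
  sSup { r : ℝ |
    ∃ y : (B : Finset (Fin k)) → ((j : B) → Fin (d j.1)) → ℝ,
      (∀ B ∈ π, pNorm p (y B) = 1) ∧
      r = ∑ i : (n : Fin k) → Fin (d n), A i * ∏ B ∈ π, y B fun j => i j.1 }

/-- The spectral norm of the unfolding of the tensor `A` induced by the
partition `π`: the supremum of `⟨A, ⊗_{B ∈ π} y_B⟩` over choices, for each block
`B ∈ π`, of a vector `y_B` indexed by `Π_{j ∈ B} Fin (d j)` with Euclidean norm 1. -/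
noncomputable def unfoldNorm {k : ℕ} (d : Fin k → ℕ)
    (A : ((n : Fin k) → Fin (d n)) → ℝ) (π : Finset (Finset (Fin k))) : ℝ :=
  sSup { r : ℝ |
    ∃ y : (B : Finset (Fin k)) → ((j : B) → Fin (d j.1)) → ℝ,
      (∀ B ∈ π, ∑ v, (y B v) ^ 2 = 1) ∧
      r = ∑ i : (n : Fin k) → Fin (d n), A i * ∏ B ∈ π, y B fun j => i j.1 }

/-- The `l^p` operator norm of the tensor `A`:
`‖A‖_p = sup { A(x₁, …, x_k) : ‖x_n‖_p = 1 }`. -/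
noncomputable def opNormP {k : ℕ} (p : ℝ≥0∞) (d : Fin k → ℕ)
    (A : ((n : Fin k) → Fin (d n)) → ℝ) : ℝ :=
  sSup { r : ℝ | ∃ x : (n : Fin k) → Fin (d n) → ℝ,
    (∀ n, pNorm p (x n) = 1) ∧
    r = ∑ i : (n : Fin k) → Fin (d n), A i * ∏ n, x n (i n) }

/-- The spectral norm of the tensor `A`:
`‖A‖_σ = sup { A(x₁, …, x_k) : ‖x_n‖₂ = 1 }`. -/
noncomputable def specNorm {k : ℕ} (d : Fin k → ℕ)
    (A : ((n : Fin k) → Fin (d n)) → ℝ) : ℝ :=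
  sSup { r : ℝ | ∃ x : (n : Fin k) → Fin (d n) → ℝ,
    (∀ n, ∑ i, (x n i) ^ 2 = 1) ∧
    r = ∑ i : (n : Fin k) → Fin (d n), A i * ∏ n, x n (i n) }

/-- The Frobenius norm of the tensor `A`. -/
noncomputable def frobNorm {k : ℕ} (d : Fin k → ℕ)
    (A : ((n : Fin k) → Fin (d n)) → ℝ) : ℝ :=
  Real.sqrt (∑ i : (n : Fin k) → Fin (d n), (A i) ^ 2)

/-- `D_A(B, B') = Π_{n ∈ B ∩ B'} d_n` if `B ∩ B' ≠ ∅`, and `0` otherwise. -/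
def blockDim {k : ℕ} (d : Fin k → ℕ) (B B' : Finset (Fin k)) : ℕ :=
  if (B ∩ B').Nonempty then ∏ n ∈ B ∩ B', d n else 0

/-- `dim_A(π₁, π₂) = Π_{B ∈ π₁} max_{B' ∈ π₂} D_A(B, B')`. -/
def dimRel {k : ℕ} (d : Fin k → ℕ) (π₁ π₂ : Finset (Finset (Fin k))) : ℕ :=
  ∏ B ∈ π₁, π₂.sup fun B' => blockDim d B B'

/-- `A` is `π`-orthogonal decomposable: `A = Σ_{n=1}^r λ_n a₁⁽ⁿ⁾ ⊗ ⋯ ⊗ a_k⁽ⁿ⁾`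
with `λ₁ ≥ ⋯ ≥ λ_r ≥ 0` and `Π_{i ∈ B} ⟨a_i⁽ⁿ⁾, a_i⁽ᵐ⁾⟩ = δ_{nm}` for every
block `B ∈ π`. -/
def IsPiOD {k : ℕ} (d : Fin k → ℕ) (A : ((n : Fin k) → Fin (d n)) → ℝ)
    (π : Finset (Finset (Fin k))) : Prop :=
  ∃ (r : ℕ) (lam : Fin r → ℝ) (a : Fin r → (n : Fin k) → Fin (d n) → ℝ),
    Antitone lam ∧ (∀ n, 0 ≤ lam n) ∧
    (∀ i, A i = ∑ n, lam n * ∏ m, a n m (i m)) ∧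
    (∀ B ∈ π, ∀ n m : Fin r,
      (∏ j ∈ B, ∑ t, a n j t * a m j t) = if n = m then 1 else 0)

end TensorUnfolding

namespace TensorUnfolding

theorem IsPartition.exists_mem {k : ℕ} {π : Finset (Finset (Fin k))} (h : IsPartition π)
    (n : Fin k) : ∃ B ∈ π, n ∈ B := by
  have hn : n ∈ π.sup id := by rw [h.2.2]; exact Finset.mem_univ n
  simpa [Finset.mem_sup] using hn

theorem IsPartition.eq_of_mem {k : ℕ} {π : Finset (Finset (Fin k))} (h : IsPartition π)
    {B C : Finset (Fin k)} (hB : B ∈ π) (hC : C ∈ π) {n : Fin k} (hnB : n ∈ B) (hnC : n ∈ C) :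
    B = C := by
  by_contra hne
  exact Finset.disjoint_left.mp (h.2.1 B hB C hC hne) hnB hnC

/-- Restriction to the blocks of a partition identifies multi-indices with families of
block multi-indices. -/
theorem IsPartition.restrict_bijective {k : ℕ} {π : Finset (Finset (Fin k))} (h : IsPartition π)
    (d : Fin k → ℕ) :
    Function.Bijective (fun (i : (n : Fin k) → Fin (d n)) (B : π) (j : B.1) => i j.1) := by
  constructor
  · intro i i' hi
    funext n
    obtain ⟨B, hB, hn⟩ := h.exists_mem n
    exact congrFun (congrFun hi ⟨B, hB⟩) ⟨n, hn⟩
  · intro g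
    choose b hb hnb using h.exists_mem
    refine ⟨fun n => g ⟨b n, hb n⟩ ⟨n, hnb n⟩, ?_⟩
    funext ⟨B, hB⟩ ⟨j, hj⟩
    have key : ∀ (C : Finset (Fin k)) (hC : C ∈ π) (hjC : j ∈ C), C = B →
        g ⟨C, hC⟩ ⟨j, hjC⟩ = g ⟨B, hB⟩ ⟨j, hj⟩ := by
      rintro C hC hjC rfl
      rfl
    exact key _ _ _ (h.eq_of_mem (hb j) hB (hnb j) hj)

/-- A sum over multi-indices of a product over blocks factorises. -/
theorem IsPartition.sum_prod_restrict {k : ℕ} {π : Finset (Finset (Fin k))} (h : IsPartition π)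
    (d : Fin k → ℕ) (f : (B : Finset (Fin k)) → ((j : B) → Fin (d j.1)) → ℝ) :
    ∑ i : (n : Fin k) → Fin (d n), ∏ B ∈ π, f B (fun j => i j.1) = ∏ B ∈ π, ∑ u, f B u := by
  rw [← Finset.prod_coe_sort π (fun B => ∑ u, f B u), Finset.prod_univ_sum]
  simp only [Fintype.piFinset_univ]
  refine Fintype.sum_bijective _ (h.restrict_bijective d) _ _ fun i => ?_
  rw [← Finset.prod_coe_sort π]

theorem pNorm_eq {p : ℝ≥0∞} (hp : p ≠ ⊤) {ι : Type} [Fintype ι] (x : ι → ℝ) :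
    pNorm p x = (∑ i, |x i| ^ p.toReal) ^ (1 / p.toReal) := by
  rw [pNorm, if_neg hp]

theorem pNorm_nonneg {p : ℝ≥0∞} (hp : p ≠ ⊤) {ι : Type} [Fintype ι] (x : ι → ℝ) :
    0 ≤ pNorm p x := by
  rw [pNorm_eq hp]
  positivity

theorem pNorm_rpow {p : ℝ≥0∞} (hp : p ≠ ⊤) (hp0 : 0 < p.toReal) {ι : Type} [Fintype ι]
    (x : ι → ℝ) : pNorm p x ^ p.toReal = ∑ i, |x i| ^ p.toReal := by
  rw [pNorm_eq hp, ← Real.rpow_mul (by positivity), one_div, inv_mul_cancel₀ hp0.ne',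
    Real.rpow_one]

theorem abs_le_pNorm {p : ℝ≥0∞} (hp : p ≠ ⊤) (hp0 : 0 < p.toReal) {ι : Type} [Fintype ι]
    (x : ι → ℝ) (i : ι) : |x i| ≤ pNorm p x := by
  rw [← Real.rpow_le_rpow_iff (abs_nonneg _) (pNorm_nonneg hp x) hp0, pNorm_rpow hp hp0]
  exact Finset.single_le_sum (f := fun i => |x i| ^ p.toReal) (fun _ _ => by positivity)
    (Finset.mem_univ i)

theorem pNorm_const_mul {p : ℝ≥0∞} (hp : p ≠ ⊤) (hp0 : 0 < p.toReal) {ι : Type} [Fintype ι]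
    (c : ℝ) (x : ι → ℝ) : pNorm p (fun i => c * x i) = |c| * pNorm p x := by
  rw [pNorm_eq hp, pNorm_eq hp]
  simp only [abs_mul, Real.mul_rpow (abs_nonneg _) (abs_nonneg _)]
  rw [← Finset.mul_sum, Real.mul_rpow (by positivity) (by positivity),
    ← Real.rpow_mul (abs_nonneg c), mul_one_div_cancel hp0.ne', Real.rpow_one]

theorem sum_mul_prod_le_unfoldNormP {k : ℕ} {p : ℝ≥0∞} (hp : p ≠ ⊤) (hp0 : 0 < p.toReal)
    (d : Fin k → ℕ) (A : ((n : Fin k) → Fin (d n)) → ℝ) (π : Finset (Finset (Fin k)))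
    (y : (B : Finset (Fin k)) → ((j : B) → Fin (d j.1)) → ℝ)
    (hy : ∀ B ∈ π, pNorm p (y B) = 1) :
    ∑ i : (n : Fin k) → Fin (d n), A i * ∏ B ∈ π, y B (fun j => i j.1) ≤ unfoldNormP p d A π := by
  refine le_csSup ⟨∑ i, |A i|, ?_⟩ ⟨y, hy, rfl⟩
  rintro r ⟨z, hz, rfl⟩
  refine Finset.sum_le_sum fun i _ => (le_abs_self _).trans ?_
  rw [abs_mul, Finset.abs_prod]
  refine mul_le_of_le_one_right (abs_nonneg _)
    (Finset.prod_le_one (fun _ _ => abs_nonneg _) fun B hB => ?_)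
  exact (abs_le_pNorm hp hp0 _ _).trans_eq (hz B hB)

/-- The homogeneous form of the bound defining the operator norm of an unfolding. -/
theorem sum_mul_prod_le_unfoldNormP_mul {k : ℕ} {p : ℝ≥0∞} (hp : p ≠ ⊤) (hp0 : 0 < p.toReal)
    (d : Fin k → ℕ) (A : ((n : Fin k) → Fin (d n)) → ℝ) (π : Finset (Finset (Fin k)))
    (z : (B : Finset (Fin k)) → ((j : B) → Fin (d j.1)) → ℝ) :
    ∑ i : (n : Fin k) → Fin (d n), A i * ∏ B ∈ π, z B (fun j => i j.1) ≤
      unfoldNormP p d A π * ∏ B ∈ π, pNorm p (z B) := by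
  by_cases h0 : ∃ B ∈ π, pNorm p (z B) = 0
  · obtain ⟨B, hB, hz⟩ := h0
    rw [Finset.prod_eq_zero hB hz, mul_zero]
    refine (Finset.sum_eq_zero fun i _ => ?_).le
    rw [Finset.prod_eq_zero hB, mul_zero]
    exact abs_nonpos_iff.mp (hz ▸ abs_le_pNorm hp hp0 (z B) _)
  · push Not at h0
    have hc : 0 < ∏ B ∈ π, pNorm p (z B) :=
      Finset.prod_pos fun B hB => (pNorm_nonneg hp _).lt_of_ne' (h0 B hB)
    have key := sum_mul_prod_le_unfoldNormP hp hp0 d A π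
      (fun B u => (pNorm p (z B))⁻¹ * z B u) fun B hB => by
        rw [pNorm_const_mul hp hp0, abs_inv, abs_of_nonneg (pNorm_nonneg hp _),
          inv_mul_cancel₀ (h0 B hB)]
    rw [← div_le_iff₀ hc, Finset.sum_div]
    refine le_of_eq_of_le (Finset.sum_congr rfl fun i _ => ?_) key
    rw [Finset.prod_mul_distrib, Finset.prod_inv_distrib, div_eq_mul_inv]
    ring

theorem unfoldNormP_nonneg {k : ℕ} {p : ℝ≥0∞} (hp : p ≠ ⊤) (hp0 : 0 < p.toReal)
    (d : Fin k → ℕ) (A : ((n : Fin k) → Fin (d n)) → ℝ) {π : Finset (Finset (Fin k))}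
    (hπ : π.Nonempty) : 0 ≤ unfoldNormP p d A π := by
  obtain ⟨B₀, hB₀⟩ := hπ
  by_cases hy : ∃ y : (B : Finset (Fin k)) → ((j : B) → Fin (d j.1)) → ℝ,
      ∀ B ∈ π, pNorm p (y B) = 1
  · obtain ⟨y, hy⟩ := hy
    have h1 := sum_mul_prod_le_unfoldNormP hp hp0 d A π y hy
    have h2 := sum_mul_prod_le_unfoldNormP hp hp0 d A π
      (fun B u => (if B = B₀ then -1 else 1) * y B u) fun B hB => by
        rw [pNorm_const_mul hp hp0, hy B hB]
        split_ifs <;> simp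
    simp only [Finset.prod_mul_distrib, Finset.prod_ite_eq', hB₀, if_true, neg_mul, one_mul,
      mul_neg, Finset.sum_neg_distrib] at h2
    linarith
  · refine Real.sSup_nonneg ?_
    rintro r ⟨y, h, -⟩
    exact absurd ⟨y, h⟩ hy

theorem card_filter_eqOn_compl {k : ℕ} (d : Fin k → ℕ) (T : Finset (Fin k))
    (i : (n : Fin k) → Fin (d n)) :
    (Finset.univ.filter fun v : (n : Fin k) → Fin (d n) => ∀ n, n ∉ T → i n = v n).card =
      ∏ n ∈ T, d n := by
  have : (Finset.univ.filter fun v : (n : Fin k) → Fin (d n) => ∀ n, n ∉ T → i n = v n) =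
      Fintype.piFinset fun n => if n ∈ T then Finset.univ else {i n} := by
    ext v
    simp only [Finset.mem_filter, Finset.mem_univ, true_and, Fintype.mem_piFinset]
    refine forall_congr' fun n => ?_
    by_cases hn : n ∈ T <;> simp [hn, eq_comm]
  rw [this, Fintype.card_piFinset, ← Finset.prod_subset (Finset.subset_univ T)]
  · exact Finset.prod_congr rfl fun n hn => by simp [hn]
  · intro n _ hn
    simp [hn]

theorem sum_sum_eqOn_compl {k : ℕ} (d : Fin k → ℕ) (T : Finset (Fin k))
    (F : ((n : Fin k) → Fin (d n)) → ℝ) :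
    ∑ v : (n : Fin k) → Fin (d n), ∑ i, (if ∀ n, n ∉ T → i n = v n then F i else 0) =
      (∏ n ∈ T, (d n : ℝ)) * ∑ i, F i := by
  rw [Finset.sum_comm, Finset.mul_sum]
  refine Finset.sum_congr rfl fun i _ => ?_
  rw [← Finset.sum_filter, Finset.sum_const, card_filter_eqOn_compl, nsmul_eq_mul]
  push_cast
  rfl

/-- The block vectors for `π₂` obtained from block vectors `y` for `π₁`, by freezing the
coordinates outside `T` at their values in `v`. -/
noncomputable def slice {k : ℕ} (d : Fin k → ℕ) (π₁ : Finset (Finset (Fin k)))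
    (φ : Finset (Fin k) → Finset (Fin k)) (T : Finset (Fin k))
    (y : (B : Finset (Fin k)) → ((j : B) → Fin (d j.1)) → ℝ)
    (v : (n : Fin k) → Fin (d n)) (C : Finset (Fin k)) (w : (j : C) → Fin (d j.1)) : ℝ :=
  if ∀ n : C, n.1 ∉ T → w n = v n.1 then
    ∏ B ∈ π₁.filter fun B => φ B = C,
      y B fun j => if h : j.1 ∈ C then w ⟨j.1, h⟩ else v j.1
  else 0

theorem prod_slice {k : ℕ} (d : Fin k → ℕ) {π₁ π₂ : Finset (Finset (Fin k))}
    (h₁ : IsPartition π₁) (h₂ : IsPartition π₂)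
    {φ : Finset (Fin k) → Finset (Fin k)} (hφ : ∀ B ∈ π₁, φ B ∈ π₂)
    (y : (B : Finset (Fin k)) → ((j : B) → Fin (d j.1)) → ℝ)
    (v i : (n : Fin k) → Fin (d n)) :
    ∏ C ∈ π₂, slice d π₁ φ (π₁.biUnion fun B => B ∩ φ B) y v C (fun j => i j.1) =
      if ∀ n, n ∉ (π₁.biUnion fun B => B ∩ φ B) → i n = v n then
        ∏ B ∈ π₁, y B (fun j => i j.1) else 0 := by
  split_ifs with h
  · rw [← Finset.prod_fiberwise_of_maps_to hφ]
    refine Finset.prod_congr rfl fun C _ => ?_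
    have hC : ∀ n : C, n.1 ∉ (π₁.biUnion fun B => B ∩ φ B) → i n.1 = v n.1 := fun n => h n.1
    rw [slice, if_pos hC]
    refine Finset.prod_congr rfl fun B hB => ?_
    obtain ⟨hB₁, rfl⟩ := Finset.mem_filter.mp hB
    congr 1
    funext j
    by_cases hj : j.1 ∈ φ B
    · rw [dif_pos hj]
    · rw [dif_neg hj, h j.1]
      intro hT
      obtain ⟨B', hB', hj'⟩ := Finset.mem_biUnion.mp hT
      rw [Finset.mem_inter] at hj'
      obtain rfl := h₁.eq_of_mem hB₁ hB' j.2 hj'.1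
      exact hj hj'.2
  · push Not at h
    obtain ⟨n, hnT, hn⟩ := h
    obtain ⟨C, hC, hnC⟩ := h₂.exists_mem n
    exact Finset.prod_eq_zero hC (if_neg fun h => hn (h ⟨n, hnC⟩ hnT))

/-- Slicing estimate: passing from `π₁` to `π₂` costs at most `(dim A / ∏_{n ∈ T} d n)^(1 - 1/p)`,
where `T` is the union of the chosen intersections `B ∩ φ B`. -/
theorem sum_mul_prod_le_of_slice {k : ℕ} {p : ℝ≥0∞} (hp : p ≠ ⊤) (hp1 : 1 ≤ p.toReal)
    (d : Fin k → ℕ) (hd : ∀ n, 1 ≤ d n)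
    (A : ((n : Fin k) → Fin (d n)) → ℝ) {π₁ π₂ : Finset (Finset (Fin k))}
    (h₁ : IsPartition π₁) (h₂ : IsPartition π₂) (hN : 0 ≤ unfoldNormP p d A π₂)
    {φ : Finset (Fin k) → Finset (Fin k)} (hφ : ∀ B ∈ π₁, φ B ∈ π₂)
    (y : (B : Finset (Fin k)) → ((j : B) → Fin (d j.1)) → ℝ)
    (hy : ∀ B ∈ π₁, pNorm p (y B) = 1) :
    ∑ i : (n : Fin k) → Fin (d n), A i * ∏ B ∈ π₁, y B (fun j => i j.1) ≤
      ((∏ n, (d n : ℝ)) / ∏ n ∈ π₁.biUnion fun B => B ∩ φ B, (d n : ℝ)) ^ (1 - 1 / p.toReal) *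
        unfoldNormP p d A π₂ := by
  set P := p.toReal with hP
  set N := unfoldNormP p d A π₂
  set T := π₁.biUnion fun B => B ∩ φ B
  set t := ∏ n ∈ T, (d n : ℝ) with ht
  have hp0 : 0 < P := by linarith
  have hd' : ∀ n, (0 : ℝ) < d n := fun n => by exact_mod_cast hd n
  have ht0 : 0 < t := Finset.prod_pos fun n _ => hd' n
  have hD0 : 0 < ∏ n, (d n : ℝ) := Finset.prod_pos fun n _ => hd' n
  let G : ((n : Fin k) → Fin (d n)) → ℝ := fun v => ∏ C ∈ π₂, pNorm p (slice d π₁ φ T y v C)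
  have hG0 : ∀ v, 0 ≤ G v := fun v => Finset.prod_nonneg fun _ _ => pNorm_nonneg hp _
  have hGP : ∀ v, G v ^ P = ∑ i : (n : Fin k) → Fin (d n),
      if ∀ n, n ∉ T → i n = v n then ∏ B ∈ π₁, |y B (fun j => i j.1)| ^ P else 0 := by
    intro v
    rw [← Real.finsetProd_rpow _ _ fun _ _ => pNorm_nonneg hp _]
    simp only [hP, pNorm_rpow hp hp0]
    rw [← h₂.sum_prod_restrict d fun C w => |slice d π₁ φ T y v C w| ^ p.toReal]
    refine Finset.sum_congr rfl fun i _ => ?_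
    rw [Real.finsetProd_rpow _ _ fun _ _ => abs_nonneg _, ← Finset.abs_prod,
      prod_slice d h₁ h₂ hφ y v i]
    split_ifs with h
    · rw [Finset.abs_prod, Real.finsetProd_rpow _ _ fun _ _ => abs_nonneg _]
    · rw [abs_zero, Real.zero_rpow hp0.ne']
  have hsumGP : ∑ v, G v ^ P = t := by
    have hone : ∏ B ∈ π₁, ∑ u, |y B u| ^ P = 1 := Finset.prod_eq_one fun B hB => by
      rw [← pNorm_rpow hp hp0, hy B hB, Real.one_rpow]
    simp only [hGP]
    rw [sum_sum_eqOn_compl d T fun i => ∏ B ∈ π₁, |y B (fun j => i j.1)| ^ P,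
      h₁.sum_prod_restrict d fun B u => |y B u| ^ P, hone, mul_one]
  have hsumG : ∑ v, G v ≤ (∏ n, (d n : ℝ)) ^ (1 - 1 / P) * t ^ (1 / P) := by
    have h := Real.rpow_sum_le_const_mul_sum_rpow_of_nonneg Finset.univ hp1
      fun v _ => hG0 v
    rw [hsumGP, Finset.card_univ, Fintype.card_pi] at h
    simp only [Fintype.card_fin, Nat.cast_prod] at h
    have hsum0 : 0 ≤ ∑ v, G v := Finset.sum_nonneg fun v _ => hG0 v
    have h' := Real.rpow_le_rpow (by positivity) h (by positivity : (0 : ℝ) ≤ 1 / P)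
    rwa [← Real.rpow_mul hsum0, mul_one_div_cancel hp0.ne',
      Real.rpow_one, Real.mul_rpow (by positivity) ht0.le, ← Real.rpow_mul hD0.le,
      sub_mul, mul_one_div_cancel hp0.ne', one_mul] at h'
  have hmain : t * ∑ i : (n : Fin k) → Fin (d n), A i * ∏ B ∈ π₁, y B (fun j => i j.1) ≤
      N * ∑ v, G v := by
    rw [ht, ← sum_sum_eqOn_compl, Finset.mul_sum]
    refine Finset.sum_le_sum fun v _ => ?_
    refine le_of_eq_of_le (Finset.sum_congr rfl fun i _ => ?_)
      (sum_mul_prod_le_unfoldNormP_mul hp hp0 d A π₂ (slice d π₁ φ T y v))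
    rw [prod_slice d h₁ h₂ hφ y v i, mul_ite, mul_zero]
  have hpow : ((∏ n, (d n : ℝ)) / t) ^ (1 - 1 / P) =
      (∏ n, (d n : ℝ)) ^ (1 - 1 / P) * t ^ (1 / P) / t := by
    rw [Real.div_rpow hD0.le ht0.le, Real.rpow_sub ht0, Real.rpow_one]
    field_simp
  rw [hpow, div_mul_eq_mul_div, le_div_iff₀ ht0, mul_comm _ t, mul_comm _ N]
  exact hmain.trans (mul_le_mul_of_nonneg_left hsumG hN)

theorem dimRel_pos {k : ℕ} (d : Fin k → ℕ) (hd : ∀ n, 1 ≤ d n)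
    {π₁ π₂ : Finset (Finset (Fin k))} (h₁ : IsPartition π₁) (h₂ : IsPartition π₂) :
    0 < dimRel d π₁ π₂ := by
  refine Finset.prod_pos fun B hB => ?_
  obtain ⟨n, hn⟩ := h₁.1 B hB
  obtain ⟨C, hC, hnC⟩ := h₂.exists_mem n
  refine lt_of_lt_of_le ?_ (Finset.le_sup (f := fun C => blockDim d B C) hC)
  simp only [blockDim]
  rw [if_pos ⟨n, Finset.mem_inter.mpr ⟨hn, hnC⟩⟩]
  exact Finset.prod_pos fun m _ => hd m

theorem exists_dimRel_le {k : ℕ} (d : Fin k → ℕ) {π₁ π₂ : Finset (Finset (Fin k))}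
    (h₁ : IsPartition π₁) (hne : π₂.Nonempty) :
    ∃ φ : Finset (Fin k) → Finset (Fin k), (∀ B ∈ π₁, φ B ∈ π₂) ∧
      dimRel d π₁ π₂ ≤ ∏ n ∈ π₁.biUnion fun B => B ∩ φ B, d n := by
  choose φ hφ hmax using fun B => Finset.exists_mem_eq_sup π₂ hne fun C => blockDim d B C
  refine ⟨φ, fun B _ => hφ B, ?_⟩
  rw [Finset.prod_biUnion]
  · refine Finset.prod_le_prod' fun B _ => ?_
    rw [hmax B, blockDim]
    split_ifs
    · exact le_rfl
    · exact Nat.zero_le _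
  · intro B hB C hC hBC
    exact (h₁.2.1 B hB C hC hBC).mono Finset.inter_subset_left Finset.inter_subset_left

/-- One-sided comparison of the `l^p` norms of two unfoldings. -/
theorem sqrt_dimRel_mul_unfoldNormP_le {k : ℕ} (d : Fin k → ℕ) (hd : ∀ n, 1 ≤ d n)
    (A : ((n : Fin k) → Fin (d n)) → ℝ) {π₁ π₂ : Finset (Finset (Fin k))}
    (h₁ : IsPartition π₁) (h₂ : IsPartition π₂)
    {p : ℝ≥0∞} (hp : p ≠ ⊤) (hp1 : 1 ≤ p.toReal) (hp2 : p.toReal ≤ 2) :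
    (dimRel d π₁ π₂ : ℝ) ^ ((1 : ℝ) / 2) * unfoldNormP p d A π₁ ≤
      (∏ n : Fin k, (d n : ℝ)) ^ (1 / p.toReal) * unfoldNormP p d A π₂ := by
  have hp0 : 0 < p.toReal := by linarith
  rcases Nat.eq_zero_or_pos k with rfl | hk
  · have hempty : ∀ {π : Finset (Finset (Fin 0))}, IsPartition π → π = ∅ := fun {π} h =>
      Finset.eq_empty_of_forall_notMem fun B hB => by
        obtain ⟨n, -⟩ := h.1 B hB
        exact n.elim0
    rw [hempty h₁, hempty h₂]
    simp [dimRel]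
  · have hne : ∀ {π : Finset (Finset (Fin k))}, IsPartition π → π.Nonempty := fun {π} h => by
      obtain ⟨B, hB, -⟩ := h.exists_mem ⟨0, hk⟩
      exact ⟨B, hB⟩
    have hN₁ := unfoldNormP_nonneg hp hp0 d A (hne h₁)
    have hN₂ := unfoldNormP_nonneg hp hp0 d A (hne h₂)
    obtain ⟨φ, hφ, hdim⟩ := exists_dimRel_le d h₁ (hne h₂)
    have hd' : ∀ n, (1 : ℝ) ≤ d n := fun n => by exact_mod_cast hd n
    have hdim' : (dimRel d π₁ π₂ : ℝ) ≤ ∏ n ∈ π₁.biUnion fun B => B ∩ φ B, (d n : ℝ) := by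
      exact_mod_cast hdim
    have hbound : unfoldNormP p d A π₁ ≤
        ((∏ n, (d n : ℝ)) / ∏ n ∈ π₁.biUnion fun B => B ∩ φ B, (d n : ℝ)) ^ (1 - 1 / p.toReal) *
          unfoldNormP p d A π₂ := by
      refine Real.sSup_le ?_ (mul_nonneg (by positivity) hN₂)
      rintro r ⟨y, hy, rfl⟩
      exact sum_mul_prod_le_of_slice hp hp1 d hd A h₁ h₂ hN₂ hφ y hy
    set t := ∏ n ∈ π₁.biUnion fun B => B ∩ φ B, (d n : ℝ) with ht
    set D := ∏ n, (d n : ℝ)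
    have ht0 : 0 < t := Finset.prod_pos fun n _ => by linarith [hd' n]
    have htD : t ≤ D := Finset.prod_le_prod_of_subset_of_one_le (Finset.subset_univ _)
      (fun n _ => by linarith [hd' n]) fun n _ _ => hd' n
    have hD1 : 1 ≤ D := Finset.one_le_prod fun n _ => hd' n
    have hq : 1 / 2 ≤ 1 / p.toReal := one_div_le_one_div_of_le hp0 hp2
    calc (dimRel d π₁ π₂ : ℝ) ^ ((1 : ℝ) / 2) * unfoldNormP p d A π₁
        ≤ t ^ ((1 : ℝ) / 2) * ((D / t) ^ (1 - 1 / p.toReal) * unfoldNormP p d A π₂) := by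
          gcongr
      _ ≤ t ^ ((1 : ℝ) / 2) * ((D / t) ^ ((1 : ℝ) / 2) * unfoldNormP p d A π₂) := by
          gcongr
          · exact (one_le_div ht0).mpr htD
          · linarith
      _ = D ^ ((1 : ℝ) / 2) * unfoldNormP p d A π₂ := by
          rw [← mul_assoc, ← Real.mul_rpow ht0.le (by positivity), mul_div_cancel₀ D ht0.ne']
      _ ≤ D ^ (1 / p.toReal) * unfoldNormP p d A π₂ := by
          gcongr

end TensorUnfolding

open TensorUnfolding in
/-- **`l^p`-norm inequalities, `1 ≤ p ≤ 2`.** For any two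
partitions `π₁, π₂` of `[k]`,
`[dim(A)]^{−1/p} [dim_A(π₁,π₂)]^{1/2} ‖Unfold_{π₁}(A)‖_p ≤ ‖Unfold_{π₂}(A)‖_p ≤
 [dim(A)]^{1/p} [dim_A(π₂,π₁)]^{−1/2} ‖Unfold_{π₁}(A)‖_p`. -/
theorem lp_norm_inequalities_low {k : ℕ} (d : Fin k → ℕ) (hd : ∀ n, 1 ≤ d n)
    (A : ((n : Fin k) → Fin (d n)) → ℝ)
    (π₁ π₂ : Finset (Finset (Fin k)))
    (h₁ : IsPartition π₁) (h₂ : IsPartition π₂)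
    (p : ℝ≥0∞) (hp1 : 1 ≤ p) (hp2 : p ≤ 2) :
    (∏ n : Fin k, (d n : ℝ)) ^ (-(1 / p).toReal) * (dimRel d π₁ π₂ : ℝ) ^ ((1 : ℝ) / 2) *
        unfoldNormP p d A π₁ ≤ unfoldNormP p d A π₂ ∧
    unfoldNormP p d A π₂ ≤
      (∏ n : Fin k, (d n : ℝ)) ^ ((1 / p).toReal) * (dimRel d π₂ π₁ : ℝ) ^ (-(1 / 2) : ℝ) *
        unfoldNormP p d A π₁ := by
  have hp : p ≠ ⊤ := ne_top_of_le_ne_top (by norm_num) hp2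
  have hp1' : 1 ≤ p.toReal := by simpa using ENNReal.toReal_mono hp hp1
  have hp2' : p.toReal ≤ 2 := by simpa using ENNReal.toReal_mono (by norm_num) hp2
  have hq : (1 / p).toReal = 1 / p.toReal := by simp
  have hD : 0 < ∏ n : Fin k, (d n : ℝ) :=
    Finset.prod_pos fun n _ => by exact_mod_cast hd n
  have hm : (0 : ℝ) < dimRel d π₂ π₁ := by exact_mod_cast dimRel_pos d hd h₂ h₁
  have h12 := sqrt_dimRel_mul_unfoldNormP_le d hd A h₁ h₂ hp hp1' hp2'
  have h21 := sqrt_dimRel_mul_unfoldNormP_le d hd A h₂ h₁ hp hp1' hp2'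
  rw [hq, Real.rpow_neg hD.le, Real.rpow_neg hm.le]
  constructor
  · rw [mul_assoc, inv_mul_le_iff₀ (by positivity)]
    exact h12
  · rw [mul_right_comm, ← div_eq_mul_inv, le_div_iff₀ (by positivity), mul_comm]
    exact h21
end

section
/- Let A be an order-k real tensor with dimensions (d₁,…,d_k) and let π be a partition of [k] with π ≠ 1_{[k]} (i.e. π has at least two blocks). If A admits a π-orthogonal decomposition with weights λ₁ ≥ λ₂ ≥ ⋯ ≥ λ_r ≥ 0, then ‖Unfold_π(A)‖_σ = λ₁. -/
open scoped BigOperators ENNReal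

namespace TensorUnfolding

/-- Restricting a multi-index to the blocks of a partition is a bijection. -/
theorem IsPartition.bijective_restrict {k : ℕ} {π : Finset (Finset (Fin k))} (hπ : IsPartition π)
    (α : Fin k → Type*) :
    Function.Bijective
      (fun (i : (n : Fin k) → α n) (B : π) (j : B.1) => i j.1) := by
  obtain ⟨-, hdisj, hcover⟩ := hπ
  have hex : ∀ n : Fin k, ∃ B : π, n ∈ B.1 := fun n => by
    have hn : n ∈ π.sup id := hcover ▸ Finset.mem_univ n
    obtain ⟨B, hB, hnB⟩ := Finset.mem_sup.1 hn
    exact ⟨⟨B, hB⟩, hnB⟩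
  constructor
  · intro i i' h
    funext n
    obtain ⟨B, hB⟩ := hex n
    exact congrFun (congrFun h B) ⟨n, hB⟩
  · intro g
    choose b hb using hex
    refine ⟨fun n => g (b n) ⟨n, hb n⟩, ?_⟩
    funext B ⟨j, hj⟩
    have hbB : b j = B := by
      by_contra hne
      exact Finset.disjoint_left.1
        (hdisj _ (b j).2 _ B.2 fun h => hne (Subtype.ext h)) (hb j) hj
    have key : ∀ (B' : π) (hj' : j ∈ B'.1), B' = B → g B' ⟨j, hj'⟩ = g B ⟨j, hj⟩ := by
      rintro B' hj' rfl
      rfl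
    exact key _ (hb j) hbB

/-- A sum over multi-indices of a product over blocks is the product of the sums over blocks. -/
theorem IsPartition.sum_prod_blocks {k : ℕ} {d : Fin k → ℕ} {π : Finset (Finset (Fin k))}
    (hπ : IsPartition π) (f : (B : Finset (Fin k)) → ((j : B) → Fin (d j.1)) → ℝ) :
    ∑ i : (n : Fin k) → Fin (d n), ∏ B ∈ π, f B (fun j => i j.1) = ∏ B ∈ π, ∑ v, f B v := by
  rw [← Finset.prod_coe_sort π (fun B => ∑ v, f B v), Finset.prod_univ_sum,
    Fintype.piFinset_univ]
  refine Fintype.sum_bijective _ (hπ.bijective_restrict fun n => Fin (d n)) _ _ fun i => ?_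
  exact (Finset.prod_coe_sort π fun B => f B fun j => i j.1).symm

theorem IsPartition.prod_eq_prod_blocks {k : ℕ} {π : Finset (Finset (Fin k))}
    (hπ : IsPartition π) (f : Fin k → ℝ) :
    ∏ m, f m = ∏ B ∈ π, ∏ j : B, f j.1 := by
  rw [← hπ.2.2, Finset.sup_eq_biUnion,
    Finset.prod_biUnion (t := id) fun B hB B' hB' h => hπ.2.1 B hB B' hB' h]
  exact Finset.prod_congr rfl fun B _ => (Finset.prod_coe_sort B f).symm

/-- The inner product of two rank-one tensors is the product of the inner products. -/
theorem sum_prod_mul_prod {k : ℕ} {d : Fin k → ℕ} (x y : (n : Fin k) → Fin (d n) → ℝ)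
    (B : Finset (Fin k)) :
    ∑ v : (j : B) → Fin (d j.1), (∏ j, x j.1 (v j)) * ∏ j, y j.1 (v j) =
      ∏ j ∈ B, ∑ t, x j t * y j t := by
  rw [← Finset.prod_coe_sort B fun j => ∑ t, x j t * y j t, Finset.prod_univ_sum,
    Fintype.piFinset_univ]
  simp only [Finset.prod_mul_distrib]

/-- Bessel's inequality for finitely indexed real vectors. -/
theorem sum_sq_dotProduct_le {ι κ : Type*} [Fintype ι] [Fintype κ] [DecidableEq κ]
    (u : κ → ι → ℝ) (hu : ∀ n m, ∑ v, u n v * u m v = if n = m then 1 else 0) (y : ι → ℝ) :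
    ∑ n, (∑ v, u n v * y v) ^ 2 ≤ ∑ v, y v ^ 2 := by
  have ho : Orthonormal ℝ fun n => (WithLp.toLp 2 (u n) : EuclideanSpace ℝ ι) := by
    rw [orthonormal_iff_ite]
    intro n m
    rw [← hu n m]
    simp [PiLp.inner_apply, mul_comm]
  have h := ho.sum_inner_products_le (s := Finset.univ) (WithLp.toLp 2 y)
  simpa [PiLp.inner_apply, EuclideanSpace.norm_sq_eq, mul_comm] using h

/-- If the rows of `c` indexed by `s` have Euclidean norm at most one and `s` has at least two
elements, then the sum of the columnwise products is at most one. -/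
theorem sum_prod_abs_le_one {β κ : Type*} [Fintype κ] {s : Finset β}
    (hs : 2 ≤ s.card) (c : κ → β → ℝ) (hc : ∀ b ∈ s, ∑ n, c n b ^ 2 ≤ 1) :
    ∑ n, ∏ b ∈ s, |c n b| ≤ 1 := by
  classical
  obtain ⟨b₁, h₁, b₂, h₂, hne⟩ := Finset.one_lt_card.1 hs
  have hle : ∀ n, ∀ b ∈ s, |c n b| ≤ 1 := fun n b hb => by
    rw [← sq_le_one_iff_abs_le_one]
    exact (Finset.single_le_sum (f := fun n => c n b ^ 2) (fun _ _ => sq_nonneg _)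
      (Finset.mem_univ n)).trans (hc b hb)
  have hterm : ∀ n, ∏ b ∈ s, |c n b| ≤ (c n b₁ ^ 2 + c n b₂ ^ 2) / 2 := fun n => by
    have hprod : ∏ b ∈ s, |c n b| ≤ ∏ b ∈ {b₁, b₂}, |c n b| :=
      Finset.prod_le_prod_of_subset_of_le_one (by simp [Finset.insert_subset_iff, h₁, h₂])
        (fun _ _ => abs_nonneg _) fun b hb _ => hle n b hb
    rw [Finset.prod_pair hne] at hprod
    nlinarith [sq_nonneg (|c n b₁| - |c n b₂|), sq_abs (c n b₁), sq_abs (c n b₂)]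
  calc ∑ n, ∏ b ∈ s, |c n b| ≤ ∑ n, (c n b₁ ^ 2 + c n b₂ ^ 2) / 2 :=
        Finset.sum_le_sum fun n _ => hterm n
    _ = (∑ n, c n b₁ ^ 2 + ∑ n, c n b₂ ^ 2) / 2 := by
        rw [← Finset.sum_div, Finset.sum_add_distrib]
    _ ≤ 1 := by linarith [hc b₁ h₁, hc b₂ h₂]

/-- The pairing of a sum of rank-one tensors with a product of block vectors. -/
theorem IsPartition.sum_mul_prod_blocks {k : ℕ} {d : Fin k → ℕ} {π : Finset (Finset (Fin k))}
    (hπ : IsPartition π) {κ : Type*} [Fintype κ] (lam : κ → ℝ)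
    (a : κ → (n : Fin k) → Fin (d n) → ℝ)
    (y : (B : Finset (Fin k)) → ((j : B) → Fin (d j.1)) → ℝ) :
    ∑ i : (n : Fin k) → Fin (d n),
        (∑ n, lam n * ∏ m, a n m (i m)) * ∏ B ∈ π, y B (fun j => i j.1) =
      ∑ n, lam n * ∏ B ∈ π, ∑ v, (∏ j : B, a n j.1 (v j)) * y B v := by
  simp_rw [Finset.sum_mul]
  rw [Finset.sum_comm]
  refine Finset.sum_congr rfl fun n _ => ?_
  rw [← hπ.sum_prod_blocks fun B v => (∏ j : B, a n j.1 (v j)) * y B v, Finset.mul_sum]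
  refine Finset.sum_congr rfl fun i _ => ?_
  rw [hπ.prod_eq_prod_blocks fun m => a n m (i m), mul_assoc, ← Finset.prod_mul_distrib]

end TensorUnfolding

open TensorUnfolding in
/-- If `π` is a partition of `[k]` with at least two blocks and
`A` admits a `π`-orthogonal decomposition with weights `λ₁ ≥ ⋯ ≥ λ_r ≥ 0`, then
`‖Unfold_π(A)‖_σ = λ₁`. -/
theorem unfoldNorm_of_piOD {k : ℕ} (d : Fin k → ℕ) (hd : ∀ n, 1 ≤ d n)
    (A : ((n : Fin k) → Fin (d n)) → ℝ)
    (π : Finset (Finset (Fin k))) (hπ : IsPartition π) (hcard : 2 ≤ π.card)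
    (r : ℕ) (hr : 0 < r) (lam : Fin r → ℝ)
    (a : Fin r → (n : Fin k) → Fin (d n) → ℝ)
    (hmono : Antitone lam) (hnonneg : ∀ n, 0 ≤ lam n)
    (hA : ∀ i, A i = ∑ n, lam n * ∏ m, a n m (i m))
    (horth : ∀ B ∈ π, ∀ n m : Fin r,
      (∏ j ∈ B, ∑ t, a n j t * a m j t) = if n = m then 1 else 0) :
    unfoldNorm d A π = lam ⟨0, hr⟩ := by
  have hu : ∀ B ∈ π, ∀ n m : Fin r,
      ∑ v : (j : B) → Fin (d j.1), (∏ j, a n j.1 (v j)) * ∏ j, a m j.1 (v j) =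
        if n = m then 1 else 0 := fun B hB n m => by
    rw [sum_prod_mul_prod, horth B hB]
  have hne : π.Nonempty := Finset.card_pos.1 (by omega)
  refine IsGreatest.csSup_eq ⟨⟨fun B v => ∏ j : B, a ⟨0, hr⟩ j.1 (v j), fun B hB => ?_, ?_⟩, ?_⟩
  · simpa [sq] using hu B hB ⟨0, hr⟩ ⟨0, hr⟩
  · simp_rw [hA]
    rw [hπ.sum_mul_prod_blocks lam a fun B v => ∏ j : B, a ⟨0, hr⟩ j.1 (v j),
      Finset.sum_eq_single ⟨0, hr⟩]
    · rw [Finset.prod_eq_one fun B hB => by simpa using hu B hB ⟨0, hr⟩ ⟨0, hr⟩, mul_one]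
    · intro n _ hn
      obtain ⟨B, hB⟩ := hne
      rw [Finset.prod_eq_zero hB (by simpa [hn] using hu B hB n ⟨0, hr⟩), mul_zero]
    · simp
  · rintro x ⟨y, hy, rfl⟩
    simp_rw [hA]
    rw [hπ.sum_mul_prod_blocks]
    have hbessel := sum_prod_abs_le_one hcard
      (fun (n : Fin r) B => ∑ v, (∏ j : B, a n j.1 (v j)) * y B v)
      fun B hB => (sum_sq_dotProduct_le _ (hu B hB) (y B)).trans (hy B hB).le
    calc _ ≤ ∑ n, lam ⟨0, hr⟩ * ∏ B ∈ π, |∑ v, (∏ j : B, a n j.1 (v j)) * y B v| := by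
          refine Finset.sum_le_sum fun n _ => ?_
          rw [← Finset.abs_prod]
          exact (mul_le_mul_of_nonneg_left (le_abs_self _) (hnonneg n)).trans
            (mul_le_mul_of_nonneg_right (hmono (Fin.mk_le_of_le_val (Nat.zero_le _)))
              (abs_nonneg _))
      _ ≤ lam ⟨0, hr⟩ := by
          rw [← Finset.mul_sum]
          exact mul_le_of_le_one_right (hnonneg _) hbessel
end

section
/- Let d₁ ≤ d₂, let D be an order-(ℓ−2) real tensor with dimensions (d₃,…,d_ℓ) (ℓ ≥ 3), and let B be the order-ℓ tensor with entries b_{i₁ i₂ i₃…i_ℓ} = δ_{i₁ i₂} · d_{i₃…i_ℓ} for i₁ ∈ {1,…,d₁}, i₂ ∈ {1,…,d₂} (i.e. B = (Σ_{i=1}^{d₁} e_{1,i}⊗e_{2,i}) ⊗ D, where e_{1,i} and e_{2,i} are standard basis vectors of ℝ^{d₁} and ℝ^{d₂}). Let C be the order-(ℓ−1) tensor obtained from B by merging its first two modes into a single mode of dimension d₁·d₂. Then ‖B‖_σ = ‖D‖_σ and ‖C‖_σ = √d₁ · ‖D‖_σ; in particular the lower bound min(d₁,d₂)^{−1/2}‖C‖_σ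 ≤ ‖B‖_σ of the one-step inequality is attained. -/
open scoped BigOperators ENNReal

namespace TensorUnfolding

/-- The spectral norm of an order-`ℓ` tensor `B` whose first two modes have
dimensions `d₁, d₂` and whose remaining `ℓ - 2 = m` modes have dimensions
`e 0, …, e (m-1)`: the supremum of `B(x₁, x₂, x₃, …, x_ℓ)` over unit vectors. -/
noncomputable def specNormB (d₁ d₂ : ℕ) {m : ℕ} (e : Fin m → ℕ)
    (B : Fin d₁ → Fin d₂ → ((n : Fin m) → Fin (e n)) → ℝ) : ℝ :=
  sSup { r : ℝ |
    ∃ (x₁ : Fin d₁ → ℝ) (x₂ : Fin d₂ → ℝ) (x : (n : Fin m) → Fin (e n) → ℝ),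
      (∑ i, (x₁ i) ^ 2 = 1) ∧ (∑ i, (x₂ i) ^ 2 = 1) ∧ (∀ n, ∑ t, (x n t) ^ 2 = 1) ∧
      r = ∑ i₁, ∑ i₂, ∑ j : (n : Fin m) → Fin (e n),
            B i₁ i₂ j * (x₁ i₁ * x₂ i₂ * ∏ n, x n (j n)) }

/-- The spectral norm of the order-`(ℓ-1)` tensor `C` obtained from `B` by merging
its first two modes into a single mode of dimension `d₁ · d₂` (indexed by pairs
`(i₁, i₂)`): the supremum of `Σ b_{i₁ i₂ j} y(i₁,i₂) x₃(j₃) ⋯ x_ℓ(j_ℓ)` over a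
unit vector `y` and unit vectors `x_n`. -/
noncomputable def specNormMerged (d₁ d₂ : ℕ) {m : ℕ} (e : Fin m → ℕ)
    (B : Fin d₁ → Fin d₂ → ((n : Fin m) → Fin (e n)) → ℝ) : ℝ :=
  sSup { r : ℝ |
    ∃ (y : Fin d₁ × Fin d₂ → ℝ) (x : (n : Fin m) → Fin (e n) → ℝ),
      (∑ v, (y v) ^ 2 = 1) ∧ (∀ n, ∑ t, (x n t) ^ 2 = 1) ∧
      r = ∑ i₁, ∑ i₂, ∑ j : (n : Fin m) → Fin (e n),
            B i₁ i₂ j * (y (i₁, i₂) * ∏ n, x n (j n)) }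

end TensorUnfolding

namespace TensorUnfolding

/-- Values of the multilinear form of `A` at unit vectors; `specNorm d A` is its supremum. -/
def unitValues {k : ℕ} (d : Fin k → ℕ) (A : ((n : Fin k) → Fin (d n)) → ℝ) : Set ℝ :=
  { r : ℝ | ∃ x : (n : Fin k) → Fin (d n) → ℝ,
    (∀ n, ∑ i, (x n i) ^ 2 = 1) ∧
    r = ∑ i : (n : Fin k) → Fin (d n), A i * ∏ n, x n (i n) }

theorem sum_sq_single {ι : Type*} [Fintype ι] [DecidableEq ι] (a : ι) :
    ∑ i, (Pi.single a (1 : ℝ) : ι → ℝ) i ^ 2 = 1 := by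
  rw [Finset.sum_eq_single a] <;> simp +contextual

theorem unitValues_nonempty {k : ℕ} {d : Fin k → ℕ} (hd : ∀ n, 1 ≤ d n)
    (A : ((n : Fin k) → Fin (d n)) → ℝ) : (unitValues d A).Nonempty :=
  ⟨_, fun n => Pi.single ⟨0, hd n⟩ 1, fun _ => sum_sq_single _, rfl⟩

theorem bddAbove_unitValues {k : ℕ} (d : Fin k → ℕ)
    (A : ((n : Fin k) → Fin (d n)) → ℝ) : BddAbove (unitValues d A) := by
  refine ⟨∑ i, |A i|, ?_⟩
  rintro _ ⟨x, hx, rfl⟩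
  refine Finset.sum_le_sum fun i _ => (le_abs_self _).trans ?_
  rw [abs_mul, Finset.abs_prod]
  refine mul_le_of_le_one_right (abs_nonneg _) ?_
  refine Finset.prod_le_one (fun _ _ => abs_nonneg _) fun n _ => ?_
  rw [← sq_le_one_iff_abs_le_one, ← hx n]
  exact Finset.single_le_sum (f := fun t => x n t ^ 2) (fun _ _ => sq_nonneg _)
    (Finset.mem_univ _)

theorem neg_mem_unitValues {k : ℕ} (hk : 1 ≤ k) {d : Fin k → ℕ}
    {A : ((n : Fin k) → Fin (d n)) → ℝ} {r : ℝ} (hr : r ∈ unitValues d A) :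
    -r ∈ unitValues d A := by
  obtain ⟨x, hx, rfl⟩ := hr
  let s : Fin k → ℝ := fun n => if n = ⟨0, hk⟩ then -1 else 1
  have hs : ∏ n, s n = -1 := by simp [s]
  refine ⟨fun n i => s n * x n i, fun n => ?_, ?_⟩
  · have hsn : s n ^ 2 = 1 := by
      simp only [s]
      split_ifs <;> norm_num
    simp only [mul_pow, hsn, one_mul, hx]
  · simp only [Finset.prod_mul_distrib, hs, neg_one_mul, mul_neg, Finset.sum_neg_distrib]

theorem sSup_eq_mul_sSup_of_scaled {S T : Set ℝ} {c : ℝ} (hc : 0 < c) (hne : S.Nonempty)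
    (hbdd : BddAbove S) (hneg : ∀ r ∈ S, -r ∈ S)
    (hle : ∀ t ∈ T, ∃ a, ∃ r ∈ S, |a| ≤ c ∧ t = a * r) (hmem : ∀ r ∈ S, c * r ∈ T) :
    sSup T = c * sSup S := by
  have hT : T.Nonempty := hne.imp' (c * ·) hmem
  refine (IsLUB.csSup_eq ⟨?_, ?_⟩ hT)
  · intro t ht
    obtain ⟨a, r, hr, ha, rfl⟩ := hle t ht
    have hr' : |r| ≤ sSup S := abs_le'.2 ⟨le_csSup hbdd hr, le_csSup hbdd (hneg r hr)⟩
    calc a * r ≤ |a| * |r| := (le_abs_self _).trans_eq (abs_mul _ _)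
      _ ≤ c * sSup S := by gcongr
  · intro b hb
    rw [mul_comm, ← le_div_iff₀ hc]
    refine csSup_le hne fun r hr => ?_
    rw [le_div_iff₀ hc, mul_comm]
    exact hb (hmem r hr)

theorem sum_delta_mul_eq {d₁ d₂ : ℕ} (h : d₁ ≤ d₂) {κ : Type*} [Fintype κ] (D p : κ → ℝ)
    (B : Fin d₁ → Fin d₂ → κ → ℝ)
    (hB : ∀ i₁ i₂ j, B i₁ i₂ j = (if (i₁ : ℕ) = (i₂ : ℕ) then 1 else 0) * D j)
    (w : Fin d₁ → Fin d₂ → ℝ) :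
    ∑ i₁, ∑ i₂, ∑ j, B i₁ i₂ j * (w i₁ i₂ * p j) =
      (∑ i, w i (Fin.castLE h i)) * ∑ j, D j * p j := by
  rw [Finset.sum_mul]
  refine Finset.sum_congr rfl fun i _ => ?_
  rw [Finset.sum_eq_single (Fin.castLE h i)]
  · rw [Finset.mul_sum]
    refine Finset.sum_congr rfl fun j _ => ?_
    rw [hB, if_pos (by simp)]
    ring
  · intro i₂ _ hne
    refine Finset.sum_eq_zero fun j _ => ?_
    rw [hB, if_neg fun he => hne (Fin.ext he.symm)]
    ring
  · simp

theorem sum_comp_sq_le {α β : Type*} [Fintype α] [Fintype β] {f : α → β}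
    (hf : Function.Injective f) (y : β → ℝ) : ∑ i, y (f i) ^ 2 ≤ ∑ v, y v ^ 2 := by
  refine (Finset.sum_map Finset.univ ⟨f, hf⟩ fun v => y v ^ 2).symm.trans_le ?_
  exact Finset.sum_le_univ_sum_of_nonneg fun _ => sq_nonneg _

theorem specNormB_delta {d₁ d₂ : ℕ} (hd₁ : 1 ≤ d₁) (hd₁₂ : d₁ ≤ d₂)
    {m : ℕ} (hm : 1 ≤ m) {e : Fin m → ℕ} (he : ∀ n, 1 ≤ e n)
    {D : ((n : Fin m) → Fin (e n)) → ℝ}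
    {B : Fin d₁ → Fin d₂ → ((n : Fin m) → Fin (e n)) → ℝ}
    (hB : ∀ i₁ i₂ j, B i₁ i₂ j = (if (i₁ : ℕ) = (i₂ : ℕ) then 1 else 0) * D j) :
    specNormB d₁ d₂ e B = specNorm e D := by
  rw [← one_mul (specNorm e D)]
  refine sSup_eq_mul_sSup_of_scaled (S := unitValues e D) one_pos (unitValues_nonempty he D)
    (bddAbove_unitValues e D) (fun _ => neg_mem_unitValues hm) ?_ ?_
  · rintro _ ⟨x₁, x₂, x, h₁, h₂, hx, rfl⟩
    refine ⟨∑ i, x₁ i * x₂ (Fin.castLE hd₁₂ i), _, ⟨x, hx, rfl⟩, ?_,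
      sum_delta_mul_eq hd₁₂ D (fun j => ∏ n, x n (j n)) B hB fun i₁ i₂ => x₁ i₁ * x₂ i₂⟩
    rw [← sq_le_one_iff_abs_le_one]
    calc (∑ i, x₁ i * x₂ (Fin.castLE hd₁₂ i)) ^ 2
        ≤ (∑ i, x₁ i ^ 2) * ∑ i, x₂ (Fin.castLE hd₁₂ i) ^ 2 :=
          Finset.sum_mul_sq_le_sq_mul_sq _ _ _
      _ ≤ 1 := by
          rw [h₁, one_mul, ← h₂]
          exact sum_comp_sq_le (Fin.castLE_injective hd₁₂) x₂
  · rintro _ ⟨x, hx, rfl⟩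
    refine ⟨Pi.single ⟨0, hd₁⟩ 1, Pi.single ⟨0, hd₁.trans hd₁₂⟩ 1, x,
      sum_sq_single _, sum_sq_single _, hx, ?_⟩
    rw [sum_delta_mul_eq hd₁₂ D (fun j => ∏ n, x n (j n)) B hB fun i₁ i₂ =>
      (Pi.single ⟨0, hd₁⟩ 1 : Fin d₁ → ℝ) i₁ * (Pi.single ⟨0, hd₁.trans hd₁₂⟩ 1 : Fin d₂ → ℝ) i₂]
    congr 1
    rw [Finset.sum_eq_single ⟨0, hd₁⟩] <;> simp +contextual [Pi.single_apply]

theorem specNormMerged_delta {d₁ d₂ : ℕ} (hd₁ : 1 ≤ d₁) (hd₁₂ : d₁ ≤ d₂)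
    {m : ℕ} (hm : 1 ≤ m) {e : Fin m → ℕ} (he : ∀ n, 1 ≤ e n)
    {D : ((n : Fin m) → Fin (e n)) → ℝ}
    {B : Fin d₁ → Fin d₂ → ((n : Fin m) → Fin (e n)) → ℝ}
    (hB : ∀ i₁ i₂ j, B i₁ i₂ j = (if (i₁ : ℕ) = (i₂ : ℕ) then 1 else 0) * D j) :
    specNormMerged d₁ d₂ e B = Real.sqrt d₁ * specNorm e D := by
  have hd : (0 : ℝ) < d₁ := by exact_mod_cast hd₁
  refine sSup_eq_mul_sSup_of_scaled (S := unitValues e D) (Real.sqrt_pos.2 hd)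
    (unitValues_nonempty he D) (bddAbove_unitValues e D) (fun _ => neg_mem_unitValues hm) ?_ ?_
  · rintro _ ⟨y, x, hy, hx, rfl⟩
    refine ⟨∑ i, y (i, Fin.castLE hd₁₂ i), _, ⟨x, hx, rfl⟩, ?_,
      sum_delta_mul_eq hd₁₂ D (fun j => ∏ n, x n (j n)) B hB fun i₁ i₂ => y (i₁, i₂)⟩
    apply Real.abs_le_sqrt
    calc (∑ i, y (i, Fin.castLE hd₁₂ i)) ^ 2
        ≤ d₁ * ∑ i, y (i, Fin.castLE hd₁₂ i) ^ 2 := by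
          simpa using sq_sum_le_card_mul_sum_sq (s := Finset.univ)
            (f := fun i => y (i, Fin.castLE hd₁₂ i))
      _ ≤ d₁ * ∑ v, y v ^ 2 := by
          gcongr
          exact sum_comp_sq_le (f := fun i => (i, Fin.castLE hd₁₂ i))
            (fun _ _ h => congrArg Prod.fst h) y
      _ = d₁ := by rw [hy, mul_one]
  · rintro _ ⟨x, hx, rfl⟩
    refine ⟨fun v => if v.2 = Fin.castLE hd₁₂ v.1 then (Real.sqrt d₁)⁻¹ else 0, x, ?_, hx, ?_⟩
    · simp [Fintype.sum_prod_type, ite_pow, hd.ne']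
    · rw [sum_delta_mul_eq hd₁₂ D (fun j => ∏ n, x n (j n)) B hB fun i₁ i₂ =>
        if i₂ = Fin.castLE hd₁₂ i₁ then (Real.sqrt d₁)⁻¹ else 0]
      congr 1
      simp [← div_eq_mul_inv]

end TensorUnfolding

open TensorUnfolding in
/-- **Sharpness of the one-step lower bound.** Let `d₁ ≤ d₂`, let
`D` be an order-`(ℓ−2)` tensor (`m = ℓ − 2 ≥ 1`), and let `B` be the order-`ℓ`
tensor with entries `b_{i₁ i₂ j} = δ_{i₁ i₂} · d_j`, i.e.
`B = (Σ_{i=1}^{d₁} e_{1,i} ⊗ e_{2,i}) ⊗ D`. Let `C` be obtained from `B` by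
merging its first two modes. Then `‖B‖_σ = ‖D‖_σ` and `‖C‖_σ = √d₁ · ‖D‖_σ`;
in particular the lower bound `min(d₁,d₂)^{−1/2} ‖C‖_σ ≤ ‖B‖_σ` of the one-step
inequality is attained with equality. -/
theorem one_step_lower_bound_sharp (d₁ d₂ : ℕ) (hd₁ : 1 ≤ d₁) (hd₁₂ : d₁ ≤ d₂)
    {m : ℕ} (hm : 1 ≤ m) (e : Fin m → ℕ) (he : ∀ n, 1 ≤ e n)
    (D : ((n : Fin m) → Fin (e n)) → ℝ)
    (B : Fin d₁ → Fin d₂ → ((n : Fin m) → Fin (e n)) → ℝ)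
    (hB : ∀ i₁ i₂ j, B i₁ i₂ j = (if (i₁ : ℕ) = (i₂ : ℕ) then 1 else 0) * D j) :
    specNormB d₁ d₂ e B = specNorm e D ∧
    specNormMerged d₁ d₂ e B = Real.sqrt d₁ * specNorm e D ∧
    ((min d₁ d₂ : ℕ) : ℝ) ^ (-(1 / 2) : ℝ) * specNormMerged d₁ d₂ e B =
      specNormB d₁ d₂ e B := by
  have hd : (0 : ℝ) < d₁ := by exact_mod_cast hd₁
  have h₁ := specNormB_delta hd₁ hd₁₂ hm he hB
  have h₂ := specNormMerged_delta hd₁ hd₁₂ hm he hB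
  refine ⟨h₁, h₂, ?_⟩
  rw [h₁, h₂, min_eq_left hd₁₂, Real.rpow_neg hd.le, ← Real.sqrt_eq_rpow,
    inv_mul_cancel_left₀ (Real.sqrt_pos.2 hd).ne']
end

section
/- Let d ≥ 1 and let A be the order-4 real tensor with all dimensions d and entries a_{i₁ i₂ i₃ i₄} = δ_{i₁ i₂} δ_{i₃ i₄} (i.e. A = I_d ⊗ I_d). Then ‖A‖_σ = 1, ‖Unfold_{π₃}(A)‖_σ = d for π₃ = {{1,2},{3,4}}, and ‖Unfold_{π₁}(A)‖_σ = √d for π₁ = {{1},{2},{3,4}}; in particular the bottom-up bounds max_{π ∈ P^ℓ_{[4]}} ‖Unfold_π(A)‖_σ = d^{(4−ℓ)/2} ‖A‖_σ are attained for ℓ = 2 and ℓ = 3. -/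
open scoped BigOperators ENNReal

namespace TensorUnfolding

open Finset

/-- Summing a product of blockwise functions over all multi-indices factors over the blocks. -/
lemma IsPartition.sum_prod_eq_prod_sum {k d : ℕ} {π : Finset (Finset (Fin k))}
    (hπ : IsPartition π) (f : (B : Finset (Fin k)) → (B → Fin d) → ℝ) :
    ∑ i : Fin k → Fin d, ∏ B ∈ π, f B (fun j => i j.1) = ∏ B ∈ π, ∑ v, f B v := by
  obtain ⟨-, hdisj, hsup⟩ := hπ
  have hcov : ∀ n : Fin k, ∃ B : π, n ∈ B.1 := fun n => by
    have hn : n ∈ π.sup id := hsup ▸ mem_univ n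
    obtain ⟨B, hB, hnB⟩ := Finset.mem_sup.1 hn
    exact ⟨⟨B, hB⟩, hnB⟩
  choose b hb using hcov
  have huniq : ∀ (n : Fin k) (B : π), n ∈ B.1 → b n = B := fun n B hn => by
    by_contra hne'
    exact (Finset.disjoint_left.1
      (hdisj _ (b n).2 _ B.2 fun h => hne' (Subtype.ext h)) (hb n)) hn
  rw [← Finset.prod_coe_sort, Finset.prod_univ_sum, Fintype.piFinset_univ]
  refine Fintype.sum_bijective (fun i (B : π) (j : B.1) => i j.1) ⟨?_, ?_⟩ _ _ ?_
  · intro i i' h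
    funext n
    exact congrFun (congrFun h (b n)) ⟨n, hb n⟩
  · intro x
    refine ⟨fun n => x (b n) ⟨n, hb n⟩, ?_⟩
    funext B j
    obtain ⟨j, hj⟩ := j
    obtain rfl := huniq j B hj
    rfl
  · intro i
    rw [← Finset.prod_coe_sort]

/-- The elementary product tensor of unit blocks has Frobenius norm one. -/
lemma IsPartition.sum_sq_prod_eq_one {k d : ℕ} {π : Finset (Finset (Fin k))}
    (hπ : IsPartition π) {y : (B : Finset (Fin k)) → (B → Fin d) → ℝ}
    (hy : ∀ B ∈ π, ∑ v, y B v ^ 2 = 1) :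
    ∑ i : Fin k → Fin d, (∏ B ∈ π, y B fun j => i j.1) ^ 2 = 1 := by
  simp_rw [← Finset.prod_pow]
  rw [hπ.sum_prod_eq_prod_sum fun B v => y B v ^ 2]
  exact Finset.prod_eq_one hy

/-- A partition with more than half as many blocks as points has a singleton block. -/
lemma IsPartition.exists_singleton_mem {k : ℕ} {π : Finset (Finset (Fin k))}
    (hπ : IsPartition π) (hcard : k < 2 * π.card) : ∃ p : Fin k, {p} ∈ π := by
  obtain ⟨hne, hdisj, hsup⟩ := hπ
  by_contra! h
  have hsum : ∑ B ∈ π, B.card = k := by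
    have := Finset.card_biUnion (s := π) (t := id) hdisj
    rw [← Finset.sup_eq_biUnion, hsup, Finset.card_univ, Fintype.card_fin] at this
    exact this.symm
  have htwo : π.card • 2 ≤ ∑ B ∈ π, B.card := by
    refine Finset.card_nsmul_le_sum _ _ _ fun B hB => ?_
    have h0 : 0 < B.card := (hne B hB).card_pos
    have h1 : B.card ≠ 1 := fun h1 => by
      obtain ⟨p, rfl⟩ := Finset.card_eq_one.1 h1
      exact h p hB
    omega
  rw [hsum, smul_eq_mul] at htwo
  omega

/-- The entries of the tensor `I_d ⊗ I_d`. -/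
def identityTensor (d : ℕ) (i : Fin 4 → Fin d) : ℝ :=
  (if i 0 = i 1 then (1 : ℝ) else 0) * (if i 2 = i 3 then 1 else 0)

lemma sum_identityTensor_mul {d : ℕ} (F : (Fin 4 → Fin d) → ℝ) :
    ∑ i, identityTensor d i * F i = ∑ a, ∑ c, F ![a, a, c, c] := by
  have hsplit (s : (Fin 4 → Fin d) → ℝ) :
      ∑ i, s i = ∑ a, ∑ b, ∑ c, ∑ e, s ![a, b, c, e] := by
    have h := Fintype.sum_bijective (fun x : Fin d × Fin d × Fin d × Fin d =>
      ![x.1, x.2.1, x.2.2.1, x.2.2.2]) ⟨?_, ?_⟩ (fun x => s ![x.1, x.2.1, x.2.2.1, x.2.2.2]) s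
      fun _ => rfl
    · simpa only [Fintype.sum_prod_type] using h.symm
    · rintro ⟨a, b, c, e⟩ ⟨a', b', c', e'⟩ h
      simpa using h
    · intro i
      refine ⟨(i 0, i 1, i 2, i 3), ?_⟩
      funext n
      fin_cases n <;> rfl
  rw [hsplit]
  have hentry (a b c e : Fin d) : identityTensor d ![a, b, c, e] =
      (if a = b then 1 else 0) * if c = e then 1 else 0 := rfl
  simp only [hentry, mul_assoc, ← Finset.mul_sum]
  simp

lemma exists_ne_identityTensor_le {d : ℕ} (p : Fin 4) : ∃ q : Fin 4, q ≠ p ∧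
    ∀ i : Fin 4 → Fin d, identityTensor d i ≤ if i p = i q then 1 else 0 := by
  have key : ∀ p q : Fin 4, (p = 0 ∧ q = 1 ∨ p = 1 ∧ q = 0 ∨ p = 2 ∧ q = 3 ∨ p = 3 ∧ q = 2) →
      ∀ i : Fin 4 → Fin d, identityTensor d i ≤ if i p = i q then 1 else 0 := by
    rintro p q (⟨rfl, rfl⟩ | ⟨rfl, rfl⟩ | ⟨rfl, rfl⟩ | ⟨rfl, rfl⟩) i <;>
      unfold identityTensor <;> split_ifs <;> simp_all
  have hpq : ∀ p : Fin 4, ∃ q : Fin 4, q ≠ p ∧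
      (p = 0 ∧ q = 1 ∨ p = 1 ∧ q = 0 ∨ p = 2 ∧ q = 3 ∨ p = 3 ∧ q = 2) := by decide
  obtain ⟨q, hne, hq⟩ := hpq p
  exact ⟨q, hne, key p q hq⟩

lemma identityTensor_sq {d : ℕ} (i : Fin 4 → Fin d) :
    identityTensor d i ^ 2 = identityTensor d i := by
  unfold identityTensor
  split_ifs <;> norm_num

lemma sum_mul_le_sqrt_mul_sqrt_of_unit {ι : Type*} [Fintype ι] {f g : ι → ℝ} {M : ℝ}
    (hf : ∑ i, f i ^ 2 ≤ M) (hg : ∑ i, g i ^ 2 ≤ 1) : ∑ i, f i * g i ≤ √M := by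
  refine (Real.sum_mul_le_sqrt_mul_sqrt univ f g).trans ?_
  calc √(∑ i, f i ^ 2) * √(∑ i, g i ^ 2) ≤ √M * 1 :=
        mul_le_mul (Real.sqrt_le_sqrt hf) (Real.sqrt_le_one.2 hg)
          (Real.sqrt_nonneg _) (Real.sqrt_nonneg _)
    _ = √M := mul_one _

lemma sum_identityTensor_mul_prod_le {d : ℕ} {π : Finset (Finset (Fin 4))}
    (hπ : IsPartition π) {y : (B : Finset (Fin 4)) → (B → Fin d) → ℝ}
    (hy : ∀ B ∈ π, ∑ v, y B v ^ 2 = 1) :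
    ∑ i, identityTensor d i * ∏ B ∈ π, y B (fun j => i j.1) ≤ d := by
  have hA : ∑ i, identityTensor d i ^ 2 ≤ (d : ℝ) ^ 2 := by
    have := sum_identityTensor_mul (d := d) fun _ => 1
    simp only [mul_one] at this
    simp_rw [identityTensor_sq, this]
    simp [sq]
  have := sum_mul_le_sqrt_mul_sqrt_of_unit hA (hπ.sum_sq_prod_eq_one hy).le
  rwa [Real.sqrt_sq d.cast_nonneg] at this

/-- Every unfolding of `I_d ⊗ I_d` has spectral norm at most its Frobenius norm `d`. -/
lemma unfoldNorm_identityTensor_le {d : ℕ} {π : Finset (Finset (Fin 4))}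
    (hπ : IsPartition π) : unfoldNorm (fun _ => d) (identityTensor d) π ≤ d := by
  refine Real.sSup_le ?_ d.cast_nonneg
  rintro r ⟨y, hy, rfl⟩
  exact sum_identityTensor_mul_prod_le hπ hy

lemma sum_singleton_block {k d : ℕ} (p : Fin k) (f : (({p} : Finset (Fin k)) → Fin d) → ℝ) :
    ∑ t : Fin d, f (fun _ => t) = ∑ v, f v := by
  refine Fintype.sum_bijective (fun t _ => t) ⟨fun s t h => congrFun h ⟨p, by simp⟩, fun v => ?_⟩
    _ _ fun _ => rfl
  refine ⟨v ⟨p, by simp⟩, ?_⟩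
  funext j
  obtain ⟨j, hj⟩ := j
  obtain rfl := Finset.mem_singleton.1 hj
  rfl

/-- Restricting a tensor that is independent of its `p`-th index to the diagonal `i p = i q`
does not change the sum, when the `p`-th index is otherwise averaged with total weight one. -/
lemma sum_filter_diagonal {k d : ℕ} {p q : Fin k} (hpq : q ≠ p) {w : Fin d → ℝ}
    (hw : ∑ t, w t = 1) {R : (Fin k → Fin d) → ℝ}
    (hR : ∀ i t, R (Function.update i p t) = R i) :
    ∑ i with i p = i q, R i = ∑ i, w (i p) * R i := by
  calc ∑ i with i p = i q, R i
      = ∑ x ∈ (univ.filter fun i : Fin k → Fin d => i p = i q) ×ˢ (univ : Finset (Fin d)),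
          w x.2 * R x.1 := by
        rw [Finset.sum_product]
        refine Finset.sum_congr rfl fun i _ => ?_
        simp [← Finset.sum_mul, hw]
    _ = ∑ i, w (i p) * R i := by
        refine Finset.sum_nbij' (fun x => Function.update x.1 p x.2)
          (fun i => (Function.update i p (i q), i p)) ?_ ?_ ?_ ?_ ?_
        · simp
        · simp [hpq]
        · rintro ⟨i, t⟩ hi
          have hi' : i p = i q := by simpa using hi
          simp [hpq, ← hi']
        · simp
        · rintro ⟨i, t⟩ -
          simp [hR]

/-- An unfolding of `I_d ⊗ I_d` with a singleton block has spectral norm at most `√d`. -/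
lemma unfoldNorm_identityTensor_le_sqrt {d : ℕ} {π : Finset (Finset (Fin 4))}
    (hπ : IsPartition π) {p : Fin 4} (hp : {p} ∈ π) :
    unfoldNorm (fun _ => d) (identityTensor d) π ≤ √d := by
  refine Real.sSup_le ?_ (Real.sqrt_nonneg _)
  rintro r ⟨y, hy, rfl⟩
  obtain ⟨q, hqp, hq⟩ := exists_ne_identityTensor_le (d := d) p
  set x : Fin d → ℝ := fun t => y {p} fun _ => t
  have hx : ∑ t, x t ^ 2 = 1 :=
    (sum_singleton_block p fun v => y {p} v ^ 2).trans (hy _ hp)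
  set R : (Fin 4 → Fin d) → ℝ := fun i => ∏ B ∈ π.erase {p}, y B fun j => i j.1
  have hP : ∀ i : Fin 4 → Fin d, ∏ B ∈ π, y B (fun j => i j.1) = x (i p) * R i := fun i => by
    rw [← Finset.mul_prod_erase π _ hp]
    congr 2
    funext j
    rw [Finset.mem_singleton.1 j.2]
  have hR : ∀ i t, R (Function.update i p t) = R i := fun i t => by
    refine Finset.prod_congr rfl fun B hB => ?_
    obtain ⟨hBp, hB⟩ := Finset.mem_erase.1 hB
    congr 1
    funext j
    refine Function.update_of_ne (fun hj => ?_) _ _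
    exact Finset.disjoint_left.1 (hπ.2.1 B hB {p} hp hBp) j.2 (by simp [hj])
  have hF : ∑ i, (identityTensor d i * x (i p)) ^ 2 ≤ (d : ℝ) := by
    simp_rw [mul_pow, identityTensor_sq]
    rw [sum_identityTensor_mul fun i => x (i p) ^ 2]
    fin_cases p <;> simp [← Finset.mul_sum, hx]
  have hG : ∑ i, (identityTensor d i * R i) ^ 2 ≤ 1 := by
    simp_rw [mul_pow, identityTensor_sq]
    calc ∑ i, identityTensor d i * R i ^ 2 ≤ ∑ i with i p = i q, R i ^ 2 := by
          rw [Finset.sum_filter]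
          refine Finset.sum_le_sum fun i _ => ?_
          simpa using mul_le_mul_of_nonneg_right (hq i) (sq_nonneg (R i))
      _ = ∑ i, x (i p) ^ 2 * R i ^ 2 :=
          sum_filter_diagonal hqp hx fun i t => by rw [hR]
      _ = 1 := by
          simp_rw [← mul_pow, ← hP]
          exact hπ.sum_sq_prod_eq_one hy
  convert sum_mul_le_sqrt_mul_sqrt_of_unit hF hG using 2 with i
  rw [hP]
  linear_combination (-(x (i p) * R i)) * identityTensor_sq i

/-- The unit vector supported uniformly on the constant multi-indices of a block. -/
noncomputable def diagonalBlock (k d : ℕ) (B : Finset (Fin k)) (v : B → Fin d) : ℝ :=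
  if ∀ j j', v j = v j' then (√d)⁻¹ else 0

lemma sum_diagonalBlock_sq {k d : ℕ} (hd : 1 ≤ d) {B : Finset (Fin k)} (hB : B.Nonempty) :
    ∑ v, diagonalBlock k d B v ^ 2 = 1 := by
  have hd0 : (d : ℝ) ≠ 0 := by positivity
  obtain ⟨b, hb⟩ := hB
  have hconst : (univ.filter fun v : B → Fin d => ∀ j j', v j = v j') =
      univ.image fun t _ => t := by
    ext v
    simp only [mem_filter, mem_univ, true_and, mem_image]
    exact ⟨fun h => ⟨v ⟨b, hb⟩, funext fun j => h _ _⟩, by rintro ⟨t, rfl⟩ _ _; rfl⟩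
  have hinj : Function.Injective fun (t : Fin d) (_ : B) => t :=
    fun s t h => congrFun h ⟨b, hb⟩
  simp only [diagonalBlock, ite_pow, ne_eq, OfNat.ofNat_ne_zero, not_false_eq_true, zero_pow]
  rw [← Finset.sum_filter, hconst, Finset.sum_const, Finset.card_image_of_injective _ hinj]
  simp [hd0]

/-- Testing an unfolding against the diagonal blocks, for a partition each of whose blocks is
constant on the support of `I_d ⊗ I_d`. -/
lemma sum_identityTensor_mul_diagonalBlock {d : ℕ} {π : Finset (Finset (Fin 4))}
    (h : ∀ B ∈ π, B ⊆ {0, 1} ∨ B ⊆ {2, 3}) :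
    ∑ i, identityTensor d i * ∏ B ∈ π, diagonalBlock 4 d B (fun j => i j.1) =
      d * d * (√d)⁻¹ ^ π.card := by
  rw [sum_identityTensor_mul fun i => ∏ B ∈ π, diagonalBlock 4 d B (fun j => i j.1)]
  have hval : ∀ a c : Fin d, ∏ B ∈ π, diagonalBlock 4 d B
      (fun j => (![a, a, c, c] : Fin 4 → Fin d) j.1) = (√d)⁻¹ ^ π.card := fun a c => by
    refine Finset.prod_eq_pow_card fun B hB => if_pos fun j j' => ?_
    obtain hB | hB := h B hB <;>
    · have hj := hB j.2
      have hj' := hB j'.2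
      simp only [Finset.mem_insert, Finset.mem_singleton] at hj hj'
      change (![a, a, c, c] : Fin 4 → Fin d) j.1 = (![a, a, c, c] : Fin 4 → Fin d) j'.1
      obtain hj | hj := hj <;> obtain hj' | hj' := hj' <;> rw [hj, hj'] <;> rfl
  simp [hval, mul_assoc]

/-- A lower bound for unfoldings of `I_d ⊗ I_d` whose blocks do not mix the two factors. -/
lemma le_unfoldNorm_identityTensor {d : ℕ} (hd : 1 ≤ d) {π : Finset (Finset (Fin 4))}
    (hπ : IsPartition π) (h : ∀ B ∈ π, B ⊆ {0, 1} ∨ B ⊆ {2, 3}) :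
    d * d * (√d)⁻¹ ^ π.card ≤ unfoldNorm (fun _ => d) (identityTensor d) π := by
  refine le_csSup ⟨d, ?_⟩ ⟨diagonalBlock 4 d,
    fun B hB => sum_diagonalBlock_sq hd (hπ.1 B hB),
    (sum_identityTensor_mul_diagonalBlock h).symm⟩
  rintro r ⟨y, hy, rfl⟩
  exact sum_identityTensor_mul_prod_le hπ hy

lemma specNorm_identityTensor {d : ℕ} (hd : 1 ≤ d) :
    specNorm (fun _ => d) (identityTensor d) = 1 := by
  have hd0 : (d : ℝ) ≠ 0 := by positivity
  have hval : ∀ x : Fin 4 → Fin d → ℝ, ∑ i, identityTensor d i * ∏ n, x n (i n) =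
      (∑ a, x 0 a * x 1 a) * ∑ c, x 2 c * x 3 c := fun x => by
    rw [sum_identityTensor_mul fun i => ∏ n, x n (i n), Finset.sum_mul_sum]
    simp [Fin.prod_univ_four, mul_assoc]
  refine IsGreatest.csSup_eq ⟨⟨fun _ _ => (√d)⁻¹, ?_, ?_⟩, ?_⟩
  · simp [hd0]
  · refine Eq.trans ?_ (hval fun _ _ => (√d)⁻¹).symm
    simp [← mul_inv, hd0]
  · rintro r ⟨x, hx, rfl⟩
    rw [hval]
    have hinner : ∀ m n, |∑ a, x m a * x n a| ≤ 1 := fun m n => by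
      rw [← sq_le_one_iff_abs_le_one]
      simpa [hx] using Finset.sum_mul_sq_le_sq_mul_sq univ (x m) (x n)
    calc _ ≤ |(∑ a, x 0 a * x 1 a) * ∑ c, x 2 c * x 3 c| := le_abs_self _
      _ ≤ 1 := by
        rw [abs_mul]
        exact mul_le_one₀ (hinner 0 1) (abs_nonneg _) (hinner 2 3)

end TensorUnfolding

open TensorUnfolding in
/-- Let `A = I_d ⊗ I_d` be the order-4 tensor with entries
`a_{i₁ i₂ i₃ i₄} = δ_{i₁ i₂} δ_{i₃ i₄}`. Then `‖A‖_σ = 1`,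
`‖Unfold_{π₃}(A)‖_σ = d` for `π₃ = {{1,2},{3,4}}`, and
`‖Unfold_{π₁}(A)‖_σ = √d` for `π₁ = {{1},{2},{3,4}}`; in particular the
bottom-up bounds `max_{π ∈ P^ℓ_{[4]}} ‖Unfold_π(A)‖_σ = d^{(4−ℓ)/2} ‖A‖_σ` are
attained for `ℓ = 2` and `ℓ = 3`. -/
theorem identity_tensor_example (d : ℕ) (hd : 1 ≤ d)
    (A : (Fin 4 → Fin d) → ℝ)
    (hA : ∀ i, A i =
      (if i 0 = i 1 then (1 : ℝ) else 0) * (if i 2 = i 3 then 1 else 0)) :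
    specNorm (fun _ : Fin 4 => d) A = 1 ∧
    unfoldNorm (fun _ : Fin 4 => d) A
        ({ {0, 1}, {2, 3} } : Finset (Finset (Fin 4))) = (d : ℝ) ∧
    unfoldNorm (fun _ : Fin 4 => d) A
        ({ {0}, {1}, {2, 3} } : Finset (Finset (Fin 4))) = Real.sqrt d ∧
    IsGreatest {r : ℝ | ∃ π : Finset (Finset (Fin 4)),
        IsPartition π ∧ π.card = 2 ∧ r = unfoldNorm (fun _ : Fin 4 => d) A π}
      ((d : ℝ) ^ (((4 : ℝ) - 2) / 2) * specNorm (fun _ : Fin 4 => d) A) ∧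
    IsGreatest {r : ℝ | ∃ π : Finset (Finset (Fin 4)),
        IsPartition π ∧ π.card = 3 ∧ r = unfoldNorm (fun _ : Fin 4 => d) A π}
      ((d : ℝ) ^ (((4 : ℝ) - 3) / 2) * specNorm (fun _ : Fin 4 => d) A) := by
  obtain rfl : A = identityTensor d := funext hA
  have hd0 : (0 : ℝ) < d := by positivity
  have hπ₂ : IsPartition ({ {0, 1}, {2, 3} } : Finset (Finset (Fin 4))) := by
    unfold IsPartition
    decide
  have hπ₃ : IsPartition ({ {0}, {1}, {2, 3} } : Finset (Finset (Fin 4))) := by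
    unfold IsPartition
    decide
  have hspec := specNorm_identityTensor hd
  have hpair : unfoldNorm (fun _ : Fin 4 => d) (identityTensor d)
      ({ {0, 1}, {2, 3} } : Finset (Finset (Fin 4))) = (d : ℝ) := by
    refine le_antisymm (unfoldNorm_identityTensor_le hπ₂) ?_
    refine le_trans (le_of_eq ?_) (le_unfoldNorm_identityTensor hd hπ₂ (by decide))
    rw [show ({ {0, 1}, {2, 3} } : Finset (Finset (Fin 4))).card = 2 by decide, inv_pow,
      Real.sq_sqrt hd0.le]
    field_simp
  have htriple : unfoldNorm (fun _ : Fin 4 => d) (identityTensor d)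
      ({ {0}, {1}, {2, 3} } : Finset (Finset (Fin 4))) = √d := by
    refine le_antisymm (unfoldNorm_identityTensor_le_sqrt hπ₃ (p := 0) (by decide)) ?_
    refine le_trans (le_of_eq ?_) (le_unfoldNorm_identityTensor hd hπ₃ (by decide))
    rw [show ({ {0}, {1}, {2, 3} } : Finset (Finset (Fin 4))).card = 3 by decide]
    have hs : √(d : ℝ) ≠ 0 := (Real.sqrt_pos.2 hd0).ne'
    field_simp
    rw [show √(d : ℝ) ^ 4 = (√(d : ℝ) ^ 2) ^ 2 by ring, Real.sq_sqrt hd0.le]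
  refine ⟨hspec, hpair, htriple, ?_, ?_⟩
  · rw [hspec, show ((4 : ℝ) - 2) / 2 = 1 by norm_num, Real.rpow_one, mul_one]
    refine ⟨⟨_, hπ₂, by decide, hpair.symm⟩, ?_⟩
    rintro r ⟨π, hπ, -, rfl⟩
    exact unfoldNorm_identityTensor_le hπ
  · rw [hspec, show ((4 : ℝ) - 3) / 2 = 1 / 2 by norm_num, ← Real.sqrt_eq_rpow, mul_one]
    refine ⟨⟨_, hπ₃, by decide, htriple.symm⟩, ?_⟩
    rintro r ⟨π, hπ, hcard, rfl⟩
    obtain ⟨p, hp⟩ := hπ.exists_singleton_mem (by omega)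
    exact unfoldNorm_identityTensor_le_sqrt hπ hp
end
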